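/- (Content of Theorem 5.5.) Let N be a finite set, (c^T)_{T≥1} a sequence of random TU cost games on N, and (Y_S)_{S⊆N} real random variables such that, almost surely, c^T(S) → Y_S as T → ∞ for every nonempty S ⊆ N. Let ε_T = max over nonempty S ⊆ N of |Y_S − c^T(S)|, let (φ_T)_{T≥1} be nonnegative reals with φ_T → 0, and let (x^T)_{T≥1} be random vectors in ℝ^N such that almost surely, for every T, Σ_{i∈S} x_i^T ≤ c^T(S) + ε_T for all nonempty S ⊊ N and |Σ_{i∈N} x_i^T − c^T(N)| ≤ φ_T. Then, almost surely, every accumulation point x of the sequence (x^T) satisfies Σ_{i∈S} x_i ≤ Y_S for all nonempty S ⊊ N and Σ_{i∈N} x_i = Y_N; that is, x belongs to the (random) core determined by (Y_S)_{S⊆N}. -/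

import Mathlib

open MeasureTheory Filter

/-- The maximum of a real-valued function over all nonempty coalitions `S ⊆ N`. -/
noncomputable def coalitionMax {N : Type*} [Fintype N] [Nonempty N]
    (f : Finset N → ℝ) : ℝ :=
  (Finset.univ.powerset.filter (fun S : Finset N => S.Nonempty)).sup'
    (by
      classical
      obtain ⟨i⟩ := (inferInstance : Nonempty N)
      exact ⟨{i}, by simp⟩) f

/-- The coalition maximum of functions tending pointwise to zero tends to zero. -/
theorem tendsto_coalitionMax_zero {N : Type*} [Fintype N] [Nonempty N]
    {g : ℕ → Finset N → ℝ}
    (hg : ∀ S : Finset N, S.Nonempty → Tendsto (fun T => g T S) atTop (nhds 0)) :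
    Tendsto (fun T => coalitionMax (g T)) atTop (nhds 0) := by
  unfold coalitionMax
  have h := Filter.Tendsto.finset_sup'_nhds_apply (l := atTop)
    (s := Finset.univ.powerset.filter (fun S : Finset N => S.Nonempty))
    (f := fun S T => g T S) (g := fun _ => (0 : ℝ))
    ⟨Finset.univ, by simp [Finset.univ_nonempty]⟩
    (fun S hS => hg S (Finset.mem_filter.mp hS).2)
  exact (Finset.sup'_const _ (0 : ℝ)) ▸ h

/-- Theorem 5.5: Let `(c^T)` be random TU cost games on a finite set `N`
and `(Y_S)` random variables with `c^T(S) → Y_S` almost surely for every nonempty `S`.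
With `ε_T = max_{∅ ≠ S ⊆ N} |Y_S − c^T(S)|` and nonnegative reals `φ_T → 0`, if the
random vectors `x^T` satisfy, almost surely for every `T`,
`Σ_{i∈S} x_i^T ≤ c^T(S) + ε_T` for all nonempty `S ⊊ N` and
`|Σ_{i∈N} x_i^T − c^T(N)| ≤ φ_T`, then almost surely every accumulation point `x` of
`(x^T)` satisfies `Σ_{i∈S} x_i ≤ Y_S` for all nonempty `S ⊊ N` and `Σ_{i∈N} x_i = Y_N`,
i.e. `x` lies in the random core determined by `(Y_S)`. -/
theorem accumulation_points_in_random_core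
    {Ω : Type*} [MeasurableSpace Ω] (P : Measure Ω) [IsProbabilityMeasure P]
    {N : Type*} [Fintype N] [Nonempty N]
    (c' : ℕ → Ω → Finset N → ℝ) (Y : Finset N → Ω → ℝ)
    (hconv : ∀ᵐ ω ∂P, ∀ S : Finset N, S.Nonempty →
      Tendsto (fun T : ℕ => c' T ω S) atTop (nhds (Y S ω)))
    -- `ε_T = max_{∅ ≠ S ⊆ N} |Y_S − c^T(S)|` at outcome `ω`
    (ε : ℕ → Ω → ℝ)
    (hε : ∀ T ω, ε T ω = coalitionMax (fun S => |Y S ω - c' T ω S|))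
    (φ : ℕ → ℝ) (hφ0 : ∀ T, 0 ≤ φ T) (hφ : Tendsto φ atTop (nhds 0))
    (x : ℕ → Ω → N → ℝ)
    (hx : ∀ᵐ ω ∂P, ∀ T : ℕ,
      (∀ S : Finset N, S.Nonempty → S ≠ Finset.univ →
        ∑ i ∈ S, x T ω i ≤ c' T ω S + ε T ω) ∧
      |∑ i, x T ω i - c' T ω Finset.univ| ≤ φ T) :
    ∀ᵐ ω ∂P, ∀ y : N → ℝ,
      (∃ f : ℕ → ℕ, StrictMono f ∧
        Tendsto (fun T : ℕ => x (f T) ω) atTop (nhds y)) →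
      (∀ S : Finset N, S.Nonempty → S ≠ Finset.univ → ∑ i ∈ S, y i ≤ Y S ω) ∧
        ∑ i, y i = Y Finset.univ ω := by
  filter_upwards [hconv, hx] with ω hc hxω
  rintro y ⟨f, hf, hy⟩
  have hft := hf.tendsto_atTop
  have hε0 : Tendsto (fun T => ε T ω) atTop (nhds 0) := by
    simp only [hε]
    refine tendsto_coalitionMax_zero fun S hS => ?_
    simpa using ((tendsto_const_nhds (x := Y S ω)).sub (hc S hS)).abs
  have hsum (S : Finset N) :
      Tendsto (fun T => ∑ i ∈ S, x (f T) ω i) atTop (nhds (∑ i ∈ S, y i)) :=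
    tendsto_finsetSum S fun i _ => (tendsto_pi_nhds.mp hy) i
  refine ⟨fun S hS hSu => ?_, ?_⟩
  · have hb := ((hc S hS).add hε0).comp hft
    rw [add_zero] at hb
    exact le_of_tendsto_of_tendsto' (hsum S) hb fun T => (hxω (f T)).1 S hS hSu
  · have hd := ((hsum Finset.univ).sub ((hc _ Finset.univ_nonempty).comp hft)).abs
    have h := le_of_tendsto_of_tendsto' hd (hφ.comp hft) fun T => (hxω (f T)).2
    exact sub_eq_zero.mp (abs_nonpos_iff.mp h)
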